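/- arXiv:2005.06156 — 6 statements merged into one kernel-verified Lean document; each statement's English description precedes it below -/
import Mathlib

section
/- Let ℓ ≥ 1000 be an even integer and let s₁ > 0. Then 2^{-18} · s₁^{-1} · ℓ^{-1/2} ≤ ∫₀^{2/(π s₁)} (sinc_{s₁}(ξ))^ℓ dξ ≤ 5 · s₁^{-1} · ℓ^{-1/2}. -/
open Real MeasureTheory

/-- `sincs s t = sin(π s t)/(π s t)` for `t ≠ 0`, and `sincs s 0 = 1`. -/
noncomputable def sincs (s t : ℝ) : ℝ := if t = 0 then 1 else Real.sin (π * s * t) / (π * s * t)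

theorem sinc_upper {u : ℝ} (h0 : 0 ≤ u) (h2 : u ≤ 2) : Real.sinc u ≤ Real.exp (-(u ^ 2 / 20)) := by
  rcases h0.eq_or_lt with rfl | hu
  · simp
  rw [Real.sinc_of_ne_zero hu.ne', div_le_iff₀ hu]
  have hpi := Real.pi_gt_three
  have hpi2 := Real.pi_lt_d2
  have h1 : Real.sin u = 2 * Real.sin (u / 2) * Real.cos (u / 2) := by
    rw [← Real.sin_two_mul]; congr 1; ring
  have hs : Real.sin (u / 2) ≤ u / 2 := Real.sin_le (by linarith)
  have hc0 : 0 ≤ Real.cos (u / 2) :=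
    Real.cos_nonneg_of_mem_Icc ⟨by linarith, by linarith⟩
  have hc : Real.cos (u / 2) ≤ 1 - 2 / π ^ 2 * (u / 2) ^ 2 :=
    Real.cos_le_one_sub_mul_cos_sq (by rw [abs_of_pos] <;> linarith)
  have hp : 1 / 5 ≤ 2 / π ^ 2 := by
    rw [div_le_div_iff₀ (by norm_num) (by positivity)]; nlinarith
  have he := Real.add_one_le_exp (-(u ^ 2 / 20))
  have hc' : Real.cos (u / 2) ≤ Real.exp (-(u ^ 2 / 20)) := by
    have := mul_le_mul_of_nonneg_right hp (sq_nonneg (u / 2))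
    linarith
  calc Real.sin u = 2 * Real.sin (u / 2) * Real.cos (u / 2) := h1
    _ ≤ u * Real.cos (u / 2) := by
      apply mul_le_mul_of_nonneg_right _ hc0; linarith
    _ ≤ _ := by rw [mul_comm]; exact mul_le_mul_of_nonneg_right hc' hu.le

theorem sinc_lower {u : ℝ} (h0 : 0 ≤ u) : 1 - u ^ 2 / 6 ≤ Real.sinc u := by
  rcases h0.eq_or_lt with rfl | hu
  · simp
  rw [Real.sinc_of_ne_zero hu.ne', le_div_iff₀ hu]
  have := Real.sin_gt_sub_cube hu
  nlinarith

theorem int_upper (ℓ : ℕ) (hev : Even ℓ) (hℓ : 1000 ≤ ℓ) :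
    ∫ u in (0:ℝ)..2, Real.sinc u ^ ℓ ≤ 15 * (√(ℓ:ℝ))⁻¹ := by
  have hl : (0:ℝ) < ℓ := by positivity
  have hb : (0:ℝ) < ℓ / 20 := by positivity
  have hI := integrable_exp_neg_mul_sq hb
  calc ∫ u in (0:ℝ)..2, Real.sinc u ^ ℓ
      ≤ ∫ u in (0:ℝ)..2, Real.exp (-(ℓ / 20 : ℝ) * u ^ 2) := by
        apply intervalIntegral.integral_mono_on (by norm_num)
        · exact (Real.continuous_sinc.pow ℓ).intervalIntegrable _ _
        · exact hI.intervalIntegrable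
        · intro u hu
          have hn : 0 ≤ Real.sinc u := by
            have := sinc_lower hu.1
            nlinarith [hu.1, hu.2]
          calc Real.sinc u ^ ℓ ≤ (Real.exp (-(u ^ 2 / 20))) ^ ℓ :=
                pow_le_pow_left₀ hn (sinc_upper hu.1 hu.2) ℓ
            _ = _ := by rw [← Real.exp_nat_mul]; congr 1; ring
    _ ≤ ∫ u : ℝ, Real.exp (-(ℓ / 20 : ℝ) * u ^ 2) := by
        rw [intervalIntegral.integral_of_le (by norm_num)]
        exact setIntegral_le_integral hI (Filter.Eventually.of_forall fun u => (Real.exp_pos _).le)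
    _ = √(π / (ℓ / 20)) := integral_gaussian _
    _ ≤ 15 * (√(ℓ:ℝ))⁻¹ := by
        rw [Real.sqrt_le_left (by positivity), mul_pow, inv_pow, Real.sq_sqrt hl.le]
        rw [div_div_eq_mul_div, div_eq_mul_inv]
        apply mul_le_mul_of_nonneg_right _ (by positivity)
        nlinarith [Real.pi_lt_d2]

theorem int_lower (ℓ : ℕ) (hev : Even ℓ) (hℓ : 1000 ≤ ℓ) :
    (1 / 2) * (√(ℓ:ℝ))⁻¹ ≤ ∫ u in (0:ℝ)..2, Real.sinc u ^ ℓ := by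
  have hl1 : (1000:ℝ) ≤ ℓ := by exact_mod_cast hℓ
  have hl : (0:ℝ) < ℓ := by positivity
  set a := (√(ℓ:ℝ))⁻¹ with ha
  have ha0 : 0 < a := by positivity
  have ha2 : a ^ 2 * ℓ = 1 := by
    rw [ha, inv_pow, Real.sq_sqrt hl.le]; field_simp
  have ha1 : a ≤ 1 := by nlinarith
  have hint : ∀ x y : ℝ, IntervalIntegrable (fun u => Real.sinc u ^ ℓ) volume x y := fun x y =>
    (Real.continuous_sinc.pow ℓ).intervalIntegrable _ _
  rw [← intervalIntegral.integral_add_adjacent_intervals (hint 0 a) (hint a 2)]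
  have h2 : 0 ≤ ∫ u in a..2, Real.sinc u ^ ℓ :=
    intervalIntegral.integral_nonneg (by linarith) fun u _ => hev.pow_nonneg _
  have h1 : ∫ u in (0:ℝ)..a, (1 / 2 : ℝ) ≤ ∫ u in (0:ℝ)..a, Real.sinc u ^ ℓ := by
    apply intervalIntegral.integral_mono_on ha0.le (by simp) (hint 0 a)
    intro u hu
    have hu2 : u ^ 2 ≤ a ^ 2 := pow_le_pow_left₀ hu.1 hu.2 2
    have hs := sinc_lower hu.1
    have hB := one_add_mul_le_pow (a := -(u ^ 2 / 6)) (by nlinarith) ℓ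
    have hP : (1 + -(u ^ 2 / 6)) ^ ℓ ≤ Real.sinc u ^ ℓ :=
      pow_le_pow_left₀ (by nlinarith) (by linarith) ℓ
    have := mul_le_mul_of_nonneg_right hu2 hl.le
    linarith
  rw [intervalIntegral.integral_const] at h1
  simp only [smul_eq_mul] at h1
  linarith

theorem stmt_0 (ℓ : ℕ) (hev : Even ℓ) (hℓ : 1000 ≤ ℓ) (s₁ : ℝ) (hs₁ : 0 < s₁) :
    ((2:ℝ) ^ (18:ℕ))⁻¹ * s₁⁻¹ * (ℓ : ℝ) ^ (-(1:ℝ)/2) ≤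
      (∫ ξ in (0:ℝ)..(2 / (π * s₁)), (sincs s₁ ξ) ^ ℓ) ∧
    (∫ ξ in (0:ℝ)..(2 / (π * s₁)), (sincs s₁ ξ) ^ ℓ) ≤ 5 * s₁⁻¹ * (ℓ : ℝ) ^ (-(1:ℝ)/2) := by
  have hl : (0:ℝ) < ℓ := by positivity
  have hpi := Real.pi_gt_three
  have hpi2 := Real.pi_lt_d2
  have hk : π * s₁ ≠ 0 := by positivity
  have hr : (ℓ : ℝ) ^ (-(1:ℝ)/2) = (√(ℓ:ℝ))⁻¹ := by
    rw [neg_div, Real.rpow_neg hl.le, Real.sqrt_eq_rpow]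
  have hf : ∀ ξ, sincs s₁ ξ = Real.sinc (π * s₁ * ξ) := by
    intro ξ
    by_cases h : ξ = 0
    · simp [sincs, h]
    · rw [Real.sinc_of_ne_zero (mul_ne_zero hk h)]; simp [sincs, h]
  have hI : (∫ ξ in (0:ℝ)..(2 / (π * s₁)), (sincs s₁ ξ) ^ ℓ) =
      s₁⁻¹ * (π⁻¹ * ∫ u in (0:ℝ)..2, Real.sinc u ^ ℓ) := by
    simp only [hf]
    rw [intervalIntegral.integral_comp_mul_left (fun u => Real.sinc u ^ ℓ) hk, mul_zero,
      mul_div_cancel₀ _ hk, smul_eq_mul, mul_inv]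
    ring
  have hA := int_upper ℓ hev hℓ
  have hB := int_lower ℓ hev hℓ
  rw [hI, hr]
  have hq : 0 < (√(ℓ:ℝ))⁻¹ := by positivity
  constructor
  · rw [mul_comm _ s₁⁻¹, mul_assoc]
    apply mul_le_mul_of_nonneg_left _ (by positivity)
    rw [inv_mul_eq_div π, le_div_iff₀ (by positivity)]
    nlinarith
  · rw [mul_comm _ s₁⁻¹, mul_assoc]
    apply mul_le_mul_of_nonneg_left _ (by positivity)
    rw [inv_mul_eq_div π, div_le_iff₀ (by positivity)]
    nlinarith
end

section
/- Let s₁, s₂ > 0 be such that s₁·s₂/2 is a positive integer, let ℓ ≥ 2 be an even integer, and define H : ℝ → ℝ by H(f) := ((sinc_{s₁})^ℓ * rect_{s₂})(f). Then H(f) ≤ H(0) for every f ∈ ℝ, i.e. H attains its maximum at 0. -/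
open Real MeasureTheory

/-- `rects s f = 1/s` if `|f| ≤ s/2`, and `0` otherwise. -/
noncomputable def rects (s f : ℝ) : ℝ := if |f| ≤ s / 2 then 1 / s else 0

lemma sincs_eq (s t : ℝ) (hs : 0 < s) : sincs s t = Real.sinc (π * s * t) := by
  unfold sincs Real.sinc
  have : π * s ≠ 0 := by positivity
  by_cases h : t = 0 <;> simp [h, this, Real.pi_ne_zero, hs.ne']

lemma sincs_cont (s : ℝ) (hs : 0 < s) (l : ℕ) : Continuous (fun t => sincs s t ^ l) := by
  have : (fun t => sincs s t ^ l) = fun t => Real.sinc (π * s * t) ^ l := by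
    funext t; rw [sincs_eq s t hs]
  rw [this]
  exact (Real.continuous_sinc.comp (by fun_prop)).pow l

lemma conv_eq (s₁ s₂ : ℝ) (hs₂ : 0 < s₂) (l : ℕ) (f : ℝ) :
    (∫ τ : ℝ, (sincs s₁ τ) ^ l * rects s₂ (f - τ)) =
      (∫ τ in (f - s₂ / 2)..(f + s₂ / 2), (sincs s₁ τ) ^ l) * (1 / s₂) := by
  rw [intervalIntegral.integral_of_le (by linarith), ← integral_Icc_eq_integral_Ioc,
    ← integral_mul_const, ← integral_indicator measurableSet_Icc]
  congr 1
  funext τ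
  unfold rects
  by_cases h : |f - τ| ≤ s₂ / 2
  · have hm : τ ∈ Set.Icc (f - s₂ / 2) (f + s₂ / 2) := by
      rw [abs_le] at h; constructor <;> linarith [h.1, h.2]
    simp [h, hm]
  · have hm : τ ∉ Set.Icc (f - s₂ / 2) (f + s₂ / 2) := by
      intro hm; apply h; rw [abs_le]; constructor <;> linarith [hm.1, hm.2]
    rw [Set.indicator_of_notMem hm, if_neg h, mul_zero]

lemma sincs_shift (s a : ℝ) (hs : 0 < s) (ha : 0 < a) (n : ℕ) (hn : s * a = n)
    (l : ℕ) (hev : Even l) (hl : 2 ≤ l) (x : ℝ) (hx : 0 ≤ x) :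
    sincs s (x + a) ^ l ≤ sincs s (x - a) ^ l := by
  have h1 : Real.sin (π * s * (x + a)) ^ l = Real.sin (π * s * x) ^ l := by
    have : π * s * (x + a) = π * s * x + n * π := by rw [← hn]; ring
    rw [this, Real.sin_add_nat_mul_pi, mul_pow, ← pow_mul, mul_comm n l, pow_mul,
      hev.neg_one_pow, one_pow, one_mul]
  have h2 : Real.sin (π * s * (x - a)) ^ l = Real.sin (π * s * x) ^ l := by
    have : π * s * (x - a) = π * s * x - n * π := by rw [← hn]; ring
    rw [this, Real.sin_sub_nat_mul_pi, mul_pow, ← pow_mul, mul_comm n l, pow_mul,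
      hev.neg_one_pow, one_pow, one_mul]
  have hp : 0 < π * s := by positivity
  by_cases h : x - a = 0
  · have : Real.sin (π * s * x) ^ l = 0 := by
      rw [← h2, h]; simp; omega
    unfold sincs
    rw [if_neg (by linarith), if_pos h, div_pow, h1, this]; simp
  · unfold sincs
    rw [if_neg (by linarith), if_neg h, div_pow, div_pow, h1, h2]
    have h3 : 0 < (π * s * (x - a)) ^ l := hev.pow_pos (mul_ne_zero hp.ne' h)
    apply div_le_div_of_nonneg_left (hev.pow_nonneg _) h3
    rw [← hev.pow_abs (π * s * (x - a))]
    apply pow_le_pow_left₀ (abs_nonneg _)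
    rw [abs_mul, abs_of_pos hp]
    apply mul_le_mul_of_nonneg_left _ hp.le
    rw [abs_le]; constructor <;> linarith

lemma sincs_neg (s t : ℝ) (hs : 0 < s) : sincs s (-t) = sincs s t := by
  rw [sincs_eq _ _ hs, sincs_eq _ _ hs, mul_neg, Real.sinc_neg]

lemma main_nonneg (s a : ℝ) (hs : 0 < s) (ha : 0 < a) (n : ℕ) (hn : s * a = n)
    (l : ℕ) (hev : Even l) (hl : 2 ≤ l) (f : ℝ) (hf : 0 ≤ f) :
    (∫ τ in (f - a)..(f + a), (sincs s τ) ^ l) ≤ ∫ τ in (0 - a)..(0 + a), (sincs s τ) ^ l := by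
  have hc := sincs_cont s hs l
  have hi : ∀ p q : ℝ, IntervalIntegrable (fun t => sincs s t ^ l) volume p q :=
    fun p q => hc.intervalIntegrable p q
  have key : (∫ x in (0:ℝ)..f, sincs s (x + a) ^ l) ≤ ∫ x in (0:ℝ)..f, sincs s (x - a) ^ l := by
    apply intervalIntegral.integral_mono_on hf
    · exact (hc.comp (continuous_id.add continuous_const)).intervalIntegrable _ _
    · exact (hc.comp (continuous_id.sub continuous_const)).intervalIntegrable _ _
    · intro x hx
      exact sincs_shift s a hs ha n hn l hev hl x hx.1
  rw [intervalIntegral.integral_comp_add_right (fun t => sincs s t ^ l),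
    intervalIntegral.integral_comp_sub_right (fun t => sincs s t ^ l)] at key
  have e1 := intervalIntegral.integral_add_adjacent_intervals (hi (0 - a) (f - a)) (hi (f - a) (f + a))
  have e2 := intervalIntegral.integral_add_adjacent_intervals (hi (0 - a) (0 + a)) (hi (0 + a) (f + a))
  linarith

theorem stmt_2 (s₁ s₂ : ℝ) (hs₁ : 0 < s₁) (hs₂ : 0 < s₂)
    (hint : ∃ n : ℕ, 0 < n ∧ s₁ * s₂ / 2 = (n : ℝ))
    (ℓ : ℕ) (hev : Even ℓ) (hℓ : 2 ≤ ℓ) (f : ℝ) :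
    (∫ τ : ℝ, (sincs s₁ τ) ^ ℓ * rects s₂ (f - τ)) ≤
      ∫ τ : ℝ, (sincs s₁ τ) ^ ℓ * rects s₂ (0 - τ) := by
  obtain ⟨n, -, hn⟩ := hint
  rw [conv_eq _ _ hs₂, conv_eq _ _ hs₂]
  apply mul_le_mul_of_nonneg_right _ (by positivity)
  have hn' : s₁ * (s₂ / 2) = n := by rw [← hn]; ring
  rcases le_total 0 f with hf | hf
  · exact main_nonneg s₁ (s₂ / 2) hs₁ (by positivity) n hn' ℓ hev hℓ f hf
  · have h := main_nonneg s₁ (s₂ / 2) hs₁ (by positivity) n hn' ℓ hev hℓ (-f) (by linarith)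
    have e := intervalIntegral.integral_comp_neg (a := f - s₂ / 2) (b := f + s₂ / 2)
      (fun t => sincs s₁ t ^ ℓ)
    simp only [sincs_neg _ _ hs₁] at e
    rw [e, show -(f + s₂ / 2) = -f - s₂ / 2 by ring, show -(f - s₂ / 2) = -f + s₂ / 2 by ring]
    exact h
end

section
/- Let s₁, s₂ > 0, let ℓ ≥ 2 be an even integer, and define H : ℝ → ℝ by H(f) := ((sinc_{s₁})^ℓ * rect_{s₂})(f). Then for every f > s₂/2 one has 0 ≤ H(f) ≤ (π · s₁ · (f − s₂/2))^{-ℓ}. -/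
open Real MeasureTheory

theorem stmt_4 (s₁ s₂ : ℝ) (hs₁ : 0 < s₁) (hs₂ : 0 < s₂)
    (ℓ : ℕ) (hev : Even ℓ) (hℓ : 2 ≤ ℓ)
    (f : ℝ) (hf : s₂ / 2 < f) :
    0 ≤ (∫ τ : ℝ, (sincs s₁ τ) ^ ℓ * rects s₂ (f - τ)) ∧
    (∫ τ : ℝ, (sincs s₁ τ) ^ ℓ * rects s₂ (f - τ)) ≤
      ((π * s₁ * (f - s₂ / 2)) ^ ℓ)⁻¹ := by
  have hnn : ∀ τ : ℝ, 0 ≤ (sincs s₁ τ) ^ ℓ * rects s₂ (f - τ) := by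
    intro τ
    apply mul_nonneg (hev.pow_nonneg _)
    unfold rects
    split_ifs <;> positivity
  refine ⟨integral_nonneg hnn, ?_⟩
  have hd : 0 < f - s₂ / 2 := by linarith
  have hc : 0 < π * s₁ * (f - s₂ / 2) := by positivity
  set C : ℝ := ((π * s₁ * (f - s₂ / 2)) ^ ℓ)⁻¹ with hC
  have hC0 : 0 ≤ C := by positivity
  have hb : ∀ τ : ℝ, (sincs s₁ τ) ^ ℓ * rects s₂ (f - τ) ≤
      (Set.Icc (f - s₂ / 2) (f + s₂ / 2)).indicator (fun _ => C * (1 / s₂)) τ := by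
    intro τ
    by_cases h : |f - τ| ≤ s₂ / 2
    · have h' := abs_le.mp h
      have hm : τ ∈ Set.Icc (f - s₂ / 2) (f + s₂ / 2) :=
        ⟨by linarith [h'.2], by linarith [h'.1]⟩
      rw [Set.indicator_of_mem hm]
      have hτ : 0 < τ := lt_of_lt_of_le hd hm.1
      simp only [rects, if_pos h, sincs, if_neg hτ.ne']
      refine mul_le_mul_of_nonneg_right ?_ (by positivity)
      rw [div_pow, div_eq_mul_inv]
      have h1 : Real.sin (π * s₁ * τ) ^ ℓ ≤ 1 := by
        rw [← hev.pow_abs]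
        exact pow_le_one₀ (abs_nonneg _) (Real.abs_sin_le_one _)
      have h2 : ((π * s₁ * τ) ^ ℓ)⁻¹ ≤ C := by
        rw [hC]
        apply inv_anti₀ (by positivity)
        apply pow_le_pow_left₀ hc.le
        exact mul_le_mul_of_nonneg_left hm.1 (by positivity)
      calc _ ≤ 1 * ((π * s₁ * τ) ^ ℓ)⁻¹ :=
            mul_le_mul_of_nonneg_right h1 (by positivity)
        _ ≤ C := by rw [one_mul]; exact h2
    · simp only [rects, if_neg h, mul_zero]
      exact Set.indicator_nonneg (fun _ _ => by positivity) _
  have hint : Integrable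
      ((Set.Icc (f - s₂ / 2) (f + s₂ / 2)).indicator (fun _ : ℝ => C * (1 / s₂))) := by
    rw [integrable_indicator_iff measurableSet_Icc]
    exact integrableOn_const (by simp)
  refine (integral_mono_of_nonneg (Filter.Eventually.of_forall hnn) hint
    (Filter.Eventually.of_forall hb)).trans ?_
  rw [integral_indicator measurableSet_Icc, setIntegral_const, Real.volume_real_Icc_of_le
    (by linarith)]
  apply le_of_eq
  rw [smul_eq_mul]
  field_simp
  ring
end

section
/- Let d ≥ 1 and B ≥ 1 be integers, let α ∈ (0,1), and fix w ∈ ℝ^d. Let b = (b_1, …, b_d) be uniformly distributed on [0,1]^d. For each coordinate r define t_r := frac(1/(2B) + w_r − b_r) ∈ [0,1), h_r := ⌊B·t_r⌋ ∈ {0,…,B−1}, and the offset o_r := t_r − h_r/B − 1/(2B) ∈ [−1/(2B), 1/(2B)). Then the probability that max_r |o_r| ≥ (1−α)/(2B) equals exactly 1 − (1−α)^d. -/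
open Real MeasureTheory

lemma off_eq (B : ℕ) (hB : 1 ≤ B) (x : ℝ) :
    Int.fract x - ((⌊(B : ℝ) * Int.fract x⌋ : ℤ) : ℝ) / B - 1 / (2 * B)
      = (Int.fract (B * x) - 1 / 2) / B := by
  have hB' : (B : ℝ) ≠ 0 := by positivity
  have h : ⌊(B : ℝ) * Int.fract x⌋ = ⌊(B : ℝ) * x⌋ - B * ⌊x⌋ := by
    rw [← Int.floor_sub_intCast]
    congr 1
    push_cast
    unfold Int.fract
    ring
  rw [h]
  unfold Int.fract
  push_cast
  field_simp
  ring

def goodS (α : ℝ) : Set ℝ := {y | |Int.fract y - 1 / 2| < (1 - α) / 2}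

lemma goodS_meas (α : ℝ) : MeasurableSet (goodS α) := by
  unfold goodS
  apply measurableSet_lt
  · exact (measurable_fract.sub_const _).abs
  · exact measurable_const

lemma int_goodS (α : ℝ) (hα : α ∈ Set.Ioo (0 : ℝ) 1) :
    ∫ y in (0 : ℝ)..1, (goodS α).indicator (fun _ => (1 : ℝ)) y = 1 - α := by
  obtain ⟨h0, h1⟩ := hα
  rw [intervalIntegral.integral_of_le zero_le_one, ← integral_Ico_eq_integral_Ioc,
    integral_indicator (goodS_meas α), setIntegral_const,
    measureReal_restrict_apply (goodS_meas α)]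
  have : goodS α ∩ Set.Ico 0 1 = Set.Ioo (α / 2) (1 - α / 2) := by
    ext y
    simp only [goodS, Set.mem_inter_iff, Set.mem_setOf_eq, Set.mem_Ico, Set.mem_Ioo, abs_lt]
    constructor
    · rintro ⟨h, hy⟩
      rw [Int.fract_eq_self.2 hy] at h
      constructor <;> linarith
    · rintro ⟨ha, hb⟩
      have hy : 0 ≤ y ∧ y < 1 := by constructor <;> linarith
      rw [Int.fract_eq_self.2 hy]
      refine ⟨⟨?_, ?_⟩, hy⟩ <;> linarith
  simp [this]
  rw [max_eq_left] <;> linarith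

lemma coord (B : ℕ) (hB : 1 ≤ B) (α : ℝ) (hα : α ∈ Set.Ioo (0 : ℝ) 1) (c : ℝ) :
    (volume.restrict (Set.Icc (0 : ℝ) 1)) {b | (B : ℝ) * (c - b) ∈ goodS α}
      = ENNReal.ofReal (1 - α) := by
  have hB' : (B : ℝ) ≠ 0 := by positivity
  have hm : MeasurableSet {b : ℝ | (B : ℝ) * (c - b) ∈ goodS α} :=
    (goodS_meas α).preimage (by fun_prop)
  have hper : Function.Periodic ((goodS α).indicator (fun _ => (1 : ℝ))) 1 := by
    intro y
    simp [Set.indicator, goodS]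
  have key : ∫ b in (0 : ℝ)..1, (goodS α).indicator (fun _ => (1 : ℝ)) (B * c - B * b) = 1 - α := by
    rw [intervalIntegral.integral_comp_sub_mul _ hB']
    have e := hper.intervalIntegral_add_zsmul_eq (B : ℤ) (B * c - B * 1)
    have e2 := hper.intervalIntegral_add_eq 0 (B * c - B * 1)
    rw [zero_add, int_goodS α hα] at e2
    rw [← e2] at e
    have e3 : (B * c - B * 1 : ℝ) + (B : ℤ) • (1 : ℝ) = B * c - B * 0 := by simp
    rw [e3] at e
    have hint : ∀ (t₁ t₂ : ℝ),
        IntervalIntegrable ((goodS α).indicator (fun _ => (1 : ℝ))) volume t₁ t₂ := by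
      intro t₁ t₂
      rw [intervalIntegrable_iff, Set.uIoc]
      exact (integrable_const (1 : ℝ)).indicator (goodS_meas α)
    rw [e hint]
    simp [hB']
  rw [← ENNReal.ofReal_toReal (measure_ne_top (volume.restrict (Set.Icc (0 : ℝ) 1)) _)]
  congr 1
  rw [← key, intervalIntegral.integral_of_le zero_le_one, ← integral_Icc_eq_integral_Ioc]
  have : (fun b : ℝ => (goodS α).indicator (fun _ => (1 : ℝ)) (B * c - B * b))
      = {b : ℝ | (B : ℝ) * (c - b) ∈ goodS α}.indicator (fun _ => (1 : ℝ)) := by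
    ext b
    rw [← mul_sub]
    simp [Set.indicator]
  rw [this, integral_indicator hm, setIntegral_const]
  simp [Measure.real]

theorem stmt_8 (d B : ℕ) (hd : 1 ≤ d) (hB : 1 ≤ B)
    (α : ℝ) (hα : α ∈ Set.Ioo (0 : ℝ) 1) (w : Fin d → ℝ) :
    (volume.restrict (Set.univ.pi fun _ : Fin d => Set.Icc (0 : ℝ) 1))
        {b : Fin d → ℝ | ∃ r : Fin d,
          (1 - α) / (2 * B) ≤
            |Int.fract (1 / (2 * B) + w r - b r) -
              ((⌊(B : ℝ) * Int.fract (1 / (2 * B) + w r - b r)⌋ : ℤ) : ℝ) / B -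
              1 / (2 * B)|} =
      ENNReal.ofReal (1 - (1 - α) ^ d) := by
  have hB' : (0 : ℝ) < B := by positivity
  have hset : {b : Fin d → ℝ | ∃ r : Fin d,
          (1 - α) / (2 * B) ≤
            |Int.fract (1 / (2 * B) + w r - b r) -
              ((⌊(B : ℝ) * Int.fract (1 / (2 * B) + w r - b r)⌋ : ℤ) : ℝ) / B -
              1 / (2 * B)|} =
      (Set.univ.pi fun r : Fin d =>
        {x : ℝ | (B : ℝ) * ((1 / (2 * B) + w r) - x) ∈ goodS α})ᶜ := by
    ext b
    simp only [Set.mem_setOf_eq, Set.mem_compl_iff, Set.mem_pi, Set.mem_univ, true_imp_iff,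
      not_forall, goodS, not_lt]
    refine exists_congr fun r => ?_
    rw [off_eq B hB, abs_div, abs_of_pos hB', ← div_div, div_le_div_iff_of_pos_right hB']
  have hm : ∀ r : Fin d, MeasurableSet
      {x : ℝ | (B : ℝ) * ((1 / (2 * B) + w r) - x) ∈ goodS α} := fun r =>
    (goodS_meas α).preimage (by fun_prop)
  have : IsProbabilityMeasure (volume.restrict (Set.Icc (0 : ℝ) 1)) := ⟨by simp⟩
  rw [hset, volume_pi, Measure.restrict_pi_pi, prob_compl_eq_one_sub
    (MeasurableSet.univ_pi hm), Measure.pi_pi]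
  simp_rw [coord B hB α hα]
  have h1 : 0 ≤ 1 - α := by linarith [hα.2]
  rw [Finset.prod_const, Finset.card_univ, Fintype.card_fin, ← ENNReal.ofReal_pow h1,
    ENNReal.ofReal_sub _ (pow_nonneg h1 d), ENNReal.ofReal_one]
end

section
/- Let d ≥ 1 and B ≥ 1 be integers, let α ∈ (0,1), let Σ be a d×d real matrix, and let b, f, f' ∈ ℝ^d. Define coordinatewise the hash h_{Σ,b}(g)_r := ⌊B·frac(1/(2B) + (Σ(g − b))_r)⌋ ∈ {0,…,B−1} and the offset o_{Σ,b}(g)_r := frac(1/(2B) + (Σ(g − b))_r) − h_{Σ,b}(g)_r/B − 1/(2B). If max_r |o_{Σ,b}(f)_r| < (1−α)/(2B) and max_r |(Σ(f − f'))_r| < α/(2B), then h_{Σ,b}(f) = h_{Σ,b}(f') in every coordinate. -/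
open Real

theorem stmt_9 (d B : ℕ) (hd : 1 ≤ d) (hB : 1 ≤ B)
    (α : ℝ) (hα : α ∈ Set.Ioo (0 : ℝ) 1)
    (A : Matrix (Fin d) (Fin d) ℝ) (b f f' : Fin d → ℝ)
    (hoff : ∀ r : Fin d,
      |Int.fract (1 / (2 * B) + A.mulVec (f - b) r) -
          ((⌊(B : ℝ) * Int.fract (1 / (2 * B) + A.mulVec (f - b) r)⌋ : ℤ) : ℝ) / B -
          1 / (2 * B)| < (1 - α) / (2 * B))
    (hclose : ∀ r : Fin d, |A.mulVec (f - f') r| < α / (2 * B)) :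
    ∀ r : Fin d,
      ⌊(B : ℝ) * Int.fract (1 / (2 * B) + A.mulVec (f - b) r)⌋ =
        ⌊(B : ℝ) * Int.fract (1 / (2 * B) + A.mulVec (f' - b) r)⌋ := by
  intro r
  have h1 := hoff r
  have h2 := hclose r
  have hy : A.mulVec (f' - b) r = A.mulVec (f - b) r - A.mulVec (f - f') r := by
    have he : f' - b = (f - b) - (f - f') := by abel
    rw [← Pi.sub_apply, ← Matrix.mulVec_sub, ← he]
  rw [hy]
  generalize A.mulVec (f - f') r = e at *
  generalize A.mulVec (f - b) r = z at *
  rw [← add_sub_assoc]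
  generalize hx : 1 / (2 * (B : ℝ)) + z = x at *
  have hB1 : (1 : ℝ) ≤ B := by exact_mod_cast hB
  have hB0 : (0 : ℝ) < B := by linarith
  have hf0 := Int.fract_nonneg x
  have hf1 := Int.fract_lt_one x
  generalize hh : ⌊(B : ℝ) * Int.fract x⌋ = h at *
  have hh0 : 0 ≤ h := by rw [← hh]; positivity
  have hhB : h + 1 ≤ (B : ℤ) := by
    have : h < (B : ℤ) := by
      rw [← hh, Int.floor_lt]
      push_cast
      nlinarith
    omega
  have hh0' : (0 : ℝ) ≤ h := by exact_mod_cast hh0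
  have hhB' : (h : ℝ) + 1 ≤ B := by exact_mod_cast hhB
  rw [abs_lt] at h1 h2
  obtain ⟨h1a, h1b⟩ := h1
  obtain ⟨h2a, h2b⟩ := h2
  have k1 : (h : ℝ) / B < Int.fract x - e := by
    have : (1 - α) / (2 * (B : ℝ)) + α / (2 * B) = 1 / (2 * B) := by field_simp; ring
    linarith
  have k2 : Int.fract x - e < ((h : ℝ) + 1) / B := by
    have : (1 - α) / (2 * (B : ℝ)) + α / (2 * B) = 1 / (2 * B) := by field_simp; ring
    have : ((h : ℝ) + 1) / B = h / B + 1 / (2 * B) + 1 / (2 * B) := by field_simp; ring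
    linarith
  have k3 : 0 ≤ (h : ℝ) / B := by positivity
  have k4 : ((h : ℝ) + 1) / B ≤ 1 := by rw [div_le_one hB0]; exact hhB'
  have hfr : Int.fract (x - e) = Int.fract x - e := by
    rw [Int.fract_eq_iff]
    refine ⟨by linarith, by linarith, ⌊x⌋, ?_⟩
    have := Int.floor_add_fract x
    linarith
  rw [hfr]
  rw [div_lt_iff₀ hB0] at k1
  rw [lt_div_iff₀ hB0] at k2
  symm
  rw [Int.floor_eq_iff]
  constructor <;> linarith
end

section
/- Let u ∈ (0, 1/5] and w ≥ 1. Let W̃ be uniformly distributed on [w, 2w] and let Θ̃ be uniformly distributed on [−π, π), independent of W̃. Then the probability that W̃·sin(Θ̃) differs from its nearest integer by at most u, i.e. ℙ[ |W̃·sin(Θ̃) − ⌊W̃·sin(Θ̃) + 1/2⌋| ≤ u ], is at most 8u. -/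
open Real MeasureTheory

lemma card_bound (u L : ℝ) (hu : 0 < u) (hu8 : u < 1 / 8) (hL : u < L) :
    ((Finset.Icc ⌈L - u⌉ ⌊2 * L + u⌋).card : ℝ) * 2 ≤ 5 * L := by
  rw [Int.card_Icc]
  have h1 : 1 ≤ ⌈L - u⌉ := Int.one_le_ceil_iff.mpr (by linarith)
  have h2 : L - u ≤ ⌈L - u⌉ := Int.le_ceil _
  have h3 : (⌊2 * L + u⌋ : ℝ) ≤ 2 * L + u := Int.floor_le _
  rcases lt_or_ge (2 * L + u) 1 with h | h
  · have : ⌊2 * L + u⌋ < 1 := Int.floor_lt.mpr (by simpa using h)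
    have : (⌊2 * L + u⌋ + 1 - ⌈L - u⌉).toNat = 0 := by omega
    rw [this]; simp; linarith
  rcases lt_or_ge (2 * L + u) 2 with h' | h'
  · have : ⌊2 * L + u⌋ < 2 := Int.floor_lt.mpr (by simpa using h')
    have : (⌊2 * L + u⌋ + 1 - ⌈L - u⌉).toNat ≤ 1 := by omega
    have : (((⌊2 * L + u⌋ + 1 - ⌈L - u⌉).toNat : ℕ) : ℝ) ≤ 1 := by exact_mod_cast this
    linarith
  · rcases le_total 0 (⌊2 * L + u⌋ + 1 - ⌈L - u⌉) with h0 | h0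
    · have e : (((⌊2 * L + u⌋ + 1 - ⌈L - u⌉).toNat : ℕ) : ℝ)
          = ((⌊2 * L + u⌋ + 1 - ⌈L - u⌉ : ℤ) : ℝ) := by
        exact_mod_cast congrArg (Int.cast (R := ℝ)) (Int.toNat_of_nonneg h0)
      rw [e]; push_cast; linarith
    · rw [Int.toNat_of_nonpos h0]; simp; linarith

lemma section_bound (u w t : ℝ) (hu : 0 < u) (hu8 : u < 1 / 8) (hw : 1 ≤ w) (ht : u < |t|) :
    volume ({x : ℝ | |x * t - ((⌊x * t + 1 / 2⌋ : ℤ) : ℝ)| ≤ u} ∩ Set.Icc w (2 * w)) ≤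
      ENNReal.ofReal (5 * u * w) := by
  set s := |t| with hs
  have hs0 : 0 < s := by linarith
  have hL : u < w * s := by nlinarith
  have hc := card_bound u (w * s) hu hu8 hL
  set F := Finset.Icc ⌈w * s - u⌉ ⌊2 * (w * s) + u⌋
  have hsub : {x : ℝ | |x * t - ((⌊x * t + 1 / 2⌋ : ℤ) : ℝ)| ≤ u} ∩ Set.Icc w (2 * w) ⊆
      ⋃ n ∈ F, Set.Icc (((n : ℝ) - u) / s) ((n + u) / s) := by
    rintro x ⟨hx, hx1, hx2⟩
    have : ∃ n : ℤ, |x * s - n| ≤ u := by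
      rcases abs_cases t with ⟨h, _⟩ | ⟨h, _⟩
      · exact ⟨_, by rw [hs, h]; exact hx⟩
      · refine ⟨-⌊x * t + 1 / 2⌋, ?_⟩
        rw [hs, h]; push_cast
        rw [← abs_neg]
        have hx' : |x * t - ((⌊x * t + 1 / 2⌋ : ℤ) : ℝ)| ≤ u := hx
        convert hx' using 2
        ring
    obtain ⟨n, hn⟩ := this
    rw [abs_le] at hn
    have a1 : w * s ≤ x * s := by gcongr
    have a2 : x * s ≤ 2 * w * s := by gcongr
    simp only [Set.mem_iUnion]
    refine ⟨n, ?_, ?_, ?_⟩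
    · rw [Finset.mem_Icc]
      exact ⟨Int.ceil_le.mpr (by linarith), Int.le_floor.mpr (by linarith)⟩
    · rw [div_le_iff₀ hs0]; linarith
    · rw [le_div_iff₀ hs0]; linarith
  calc _ ≤ volume (⋃ n ∈ F, Set.Icc (((n : ℝ) - u) / s) ((n + u) / s)) := measure_mono hsub
    _ ≤ ∑ n ∈ F, volume (Set.Icc (((n : ℝ) - u) / s) ((n + u) / s)) :=
        measure_biUnion_finset_le _ _
    _ = ∑ n ∈ F, ENNReal.ofReal (2 * u / s) := by
        refine Finset.sum_congr rfl fun n _ => ?_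
        rw [Real.volume_Icc]; congr 1; ring
    _ = ENNReal.ofReal (F.card * (2 * u / s)) := by
        rw [Finset.sum_const, nsmul_eq_mul, ENNReal.ofReal_mul (by positivity),
          ENNReal.ofReal_natCast]
    _ ≤ _ := by
        apply ENNReal.ofReal_le_ofReal
        rw [← mul_div_assoc, div_le_iff₀ hs0]
        nlinarith

lemma sin_bound (u : ℝ) (hu : 0 < u) :
    volume ({y : ℝ | |Real.sin y| ≤ u} ∩ Set.Ico (-π) π) ≤ ENNReal.ofReal (2 * π * u) := by
  have hpi := Real.pi_pos
  have key : ∀ x, 0 ≤ x → x ≤ π / 2 → Real.sin x ≤ u → x ≤ π * u / 2 := by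
    intro x h0 h1 h2
    have h := Real.mul_le_sin h0 h1
    have : x = (2 / π * x) * (π / 2) := by field_simp
    have h3 : 2 / π * x ≤ u := h.trans h2
    rw [this]; nlinarith
  have hsub : {y : ℝ | |Real.sin y| ≤ u} ∩ Set.Ico (-π) π ⊆
      (Set.Icc (-(π * u / 2)) (π * u / 2) ∪ Set.Icc (-π) (-π + π * u / 2)) ∪
        Set.Icc (π - π * u / 2) π := by
    rintro y ⟨hy, hy1, hy2⟩
    have hy' : |Real.sin y| ≤ u := hy
    rw [abs_le] at hy'
    have : 0 < π * u / 2 := by positivity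
    rcases le_total y 0 with h | h
    · rcases le_total y (-(π / 2)) with h' | h'
      · left; right
        have := key (y + π) (by linarith) (by linarith) (by rw [Real.sin_add_pi]; linarith)
        constructor <;> linarith
      · left; left
        have := key (-y) (by linarith) (by linarith) (by rw [Real.sin_neg]; linarith)
        constructor <;> linarith
    · rcases le_total y (π / 2) with h' | h'
      · left; left
        have := key y (by linarith) (by linarith) (by linarith)
        constructor <;> linarith
      · right
        have := key (π - y) (by linarith) (by linarith) (by rw [Real.sin_pi_sub]; linarith)
        constructor <;> linarith
  refine (measure_mono hsub).trans ((measure_union_le _ _).trans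
    ((add_le_add_left (measure_union_le _ _) _).trans ?_))
  rw [Real.volume_Icc, Real.volume_Icc, Real.volume_Icc, ← ENNReal.ofReal_add,
    ← ENNReal.ofReal_add]
  · apply ENNReal.ofReal_le_ofReal; linarith
  all_goals nlinarith [mul_pos hpi hu]

theorem stmt_10 (u w : ℝ) (hu : u ∈ Set.Ioc (0 : ℝ) (1 / 5)) (hw : 1 ≤ w) :
    (((ENNReal.ofReal w)⁻¹ • volume.restrict (Set.Icc w (2 * w))).prod
        ((ENNReal.ofReal (2 * π))⁻¹ • volume.restrict (Set.Ico (-π) π)))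
        {p : ℝ × ℝ |
          |p.1 * Real.sin p.2 - ((⌊p.1 * Real.sin p.2 + 1 / 2⌋ : ℤ) : ℝ)| ≤ u} ≤
      ENNReal.ofReal (8 * u) := by
  obtain ⟨hu0, -⟩ := hu
  have hpi := Real.pi_pos
  have hw0 : 0 < w := by linarith
  have hwne : ENNReal.ofReal w ≠ 0 := by simpa using hw0
  have hpne : ENNReal.ofReal (2 * π) ≠ 0 := by simpa using hpi
  set μ := (ENNReal.ofReal w)⁻¹ • volume.restrict (Set.Icc w (2 * w)) with hμ
  set ν := (ENNReal.ofReal (2 * π))⁻¹ • volume.restrict (Set.Ico (-π) π) with hν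
  have : IsProbabilityMeasure μ := ⟨by
    rw [hμ, Measure.smul_apply, Measure.restrict_apply_univ, Real.volume_Icc, smul_eq_mul,
      show 2 * w - w = w by ring]
    exact ENNReal.inv_mul_cancel hwne ENNReal.ofReal_ne_top⟩
  have : IsProbabilityMeasure ν := ⟨by
    rw [hν, Measure.smul_apply, Measure.restrict_apply_univ, Real.volume_Ico, smul_eq_mul,
      show π - -π = 2 * π by ring]
    exact ENNReal.inv_mul_cancel hpne ENNReal.ofReal_ne_top⟩
  rcases le_or_gt (1 / 8) u with h8 | h8
  · refine prob_le_one.trans ?_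
    rw [ENNReal.one_le_ofReal]; linarith
  have hf : Measurable fun p : ℝ × ℝ => p.1 * Real.sin p.2 := by fun_prop
  have hfl : Measurable fun p : ℝ × ℝ => ((⌊p.1 * Real.sin p.2 + 1 / 2⌋ : ℤ) : ℝ) :=
    (measurable_from_top (f := fun n : ℤ => (n : ℝ))).comp
      (Int.measurable_floor.comp (hf.add_const _))
  have hmeas : MeasurableSet {p : ℝ × ℝ |
      |p.1 * Real.sin p.2 - ((⌊p.1 * Real.sin p.2 + 1 / 2⌋ : ℤ) : ℝ)| ≤ u} :=
    measurableSet_le (hf.sub hfl).abs measurable_const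
  rw [Measure.prod_apply_symm hmeas]
  have hB : MeasurableSet {y : ℝ | |Real.sin y| ≤ u} :=
    measurableSet_le (by fun_prop) measurable_const
  calc _ ≤ ∫⁻ y, (ENNReal.ofReal (5 * u) + {y : ℝ | |Real.sin y| ≤ u}.indicator 1 y) ∂ν := by
        refine lintegral_mono fun y => ?_
        by_cases hy : |Real.sin y| ≤ u
        · rw [Set.indicator_of_mem (by exact hy)]
          exact prob_le_one.trans le_add_self
        · refine le_trans ?_ le_self_add
          have h := section_bound u w (Real.sin y) hu0 h8 hw (not_le.mp hy)
          rw [hμ, Measure.smul_apply, Measure.restrict_apply' measurableSet_Icc, smul_eq_mul]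
          refine (mul_le_mul_right h _).trans ?_
          rw [ENNReal.ofReal_mul (by positivity), mul_comm, mul_assoc,
            ENNReal.mul_inv_cancel hwne ENNReal.ofReal_ne_top, mul_one]
    _ = ENNReal.ofReal (5 * u) + ν {y : ℝ | |Real.sin y| ≤ u} := by
        rw [lintegral_add_left measurable_const, lintegral_const, measure_univ, mul_one,
          lintegral_indicator_one hB]
    _ ≤ ENNReal.ofReal (5 * u) + ENNReal.ofReal u := by
        gcongr
        rw [hν, Measure.smul_apply, Measure.restrict_apply' measurableSet_Ico, smul_eq_mul]
        refine (mul_le_mul_right (sin_bound u hu0) _).trans ?_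
        rw [ENNReal.ofReal_mul (p := 2 * π) (q := u) (by positivity), ← mul_assoc,
            ENNReal.inv_mul_cancel hpne ENNReal.ofReal_ne_top, one_mul]
    _ ≤ _ := by
        rw [← ENNReal.ofReal_add (by positivity) hu0.le]
        apply ENNReal.ofReal_le_ofReal; linarith
end
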